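/- arXiv:2009.06120 — 8 statements merged into one kernel-verified Lean document; each statement's English description precedes it below -/
import Mathlib

section
/- Let f : ℝ × ℝⁿ → ℝⁿ be continuous, T > 0, and let X₀, X ⊆ ℝⁿ. Let x : ℝ → ℝⁿ be an admissible trajectory on [0, T] (x(0) ∈ X₀, x(t) ∈ X and x'(t) = f(t, x(t)) for all t ∈ [0, T]), and fix t_p ∈ [0, T]. Define μ₀ = δ_{x(0)} (Dirac measure at x(0)), μ_p = δ_{(t_p, x(t_p))}, and μ the pushforward of Lebesgue measure restricted to [0, t_p] under s ↦ (s, x(s)). Then: (i) μ₀ is a probability measure supported on X₀; (ii) μ and μ_p are finite Borel measures supported on [0, T] × X; (iii) the weak Liouville constraint ∫ v dμ_p = ∫ v(0, y) dμ₀(y) + ∫ L_f v dμ holds for every continuously differentiable v : ℝ × ℝⁿ → ℝ; and (iv) for any continuous p : ℝⁿ → ℝ, the objective value satisfies ∫ p(y) dμ_p(t, y) = p(x(t_p)). Consequently the infinite-dimensional measure program for peak estimation is feasible with objective value p(x(t_p)), so its optimal value upper bounds the peak value achieved by any admissible trajectory. -/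
open MeasureTheory

/-- The fundamental theorem of calculus for a `C¹` function along an integral curve of `f`. -/
theorem integral_fderiv_along_trajectory {E : Type*} [NormedAddCommGroup E] [NormedSpace ℝ E]
    {f : ℝ × E → E} (hf : Continuous f) {x : ℝ → E} (hx : Differentiable ℝ x) {a b : ℝ}
    (hode : ∀ t ∈ Set.uIcc a b, deriv x t = f (t, x t)) {v : ℝ × E → ℝ} (hv : ContDiff ℝ 1 v) :
    ∫ s in a..b, fderiv ℝ v (s, x s) (1, f (s, x s)) = v (b, x b) - v (a, x a) := by
  have hx_cont := hx.continuous
  have hfderiv : Continuous (fderiv ℝ v) := hv.continuous_fderiv one_ne_zero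
  refine intervalIntegral.integral_eq_sub_of_hasDerivAt (f := fun s => v (s, x s))
    (fun s hs => ?_) ?_
  · have hcurve : HasDerivAt (fun s => (s, x s)) ((1 : ℝ), f (s, x s)) s :=
      (hasDerivAt_id s).prodMk (hode s hs ▸ (hx s).hasDerivAt)
    exact ((hv.differentiable one_ne_zero) (s, x s)).hasFDerivAt.comp_hasDerivAt s hcurve
  · exact Continuous.intervalIntegrable (by fun_prop) a b

/-- An admissible trajectory `x(·)` on `[0, T]` (with `x(0) ∈ X₀`, `x(t) ∈ X`,
`x'(t) = f(t, x(t))`) together with a peak time `t_p ∈ [0, T]` yields a feasible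
point of the peak-estimation measure program: with `μ₀ = δ_{x(0)}`,
`μ_p = δ_{(t_p, x(t_p))}` and `μ` the occupation measure (pushforward of
`Leb|_{[0, t_p]}` under `s ↦ (s, x(s))`):
(i) `μ₀` is a probability measure supported on `X₀`;
(ii) `μ` and `μ_p` are finite measures supported on `[0, T] × X`;
(iii) the weak Liouville constraint holds for every `C¹` test function `v`, with
`L_f v(t, y) = ∂_t v(t, y) + ∇_y v(t, y)ᵀ f(t, y) = Dv(t,y)[(1, f(t,y))]`;
(iv) for any continuous `p`, the objective satisfies `∫ p dμ_p = p(x(t_p))`. -/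
theorem peak_measure_program_feasible {n : ℕ}
    (f : ℝ × (Fin n → ℝ) → (Fin n → ℝ)) (hf : Continuous f)
    (T : ℝ) (hT : 0 < T) (X₀ X : Set (Fin n → ℝ))
    (x : ℝ → (Fin n → ℝ)) (hx : Differentiable ℝ x)
    (hx0 : x 0 ∈ X₀) (hxX : ∀ t ∈ Set.Icc (0 : ℝ) T, x t ∈ X)
    (hode : ∀ t ∈ Set.Icc (0 : ℝ) T, deriv x t = f (t, x t))
    (tp : ℝ) (htp : tp ∈ Set.Icc (0 : ℝ) T) :
    (IsProbabilityMeasure (Measure.dirac (x 0))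
        ∧ Measure.dirac (x 0) (X₀ᶜ) = 0)
    ∧ (IsFiniteMeasure
          (Measure.map (fun s => (s, x s)) (volume.restrict (Set.Icc (0 : ℝ) tp)))
        ∧ Measure.map (fun s => (s, x s)) (volume.restrict (Set.Icc (0 : ℝ) tp))
            ((Set.Icc (0 : ℝ) T ×ˢ X)ᶜ) = 0
        ∧ IsFiniteMeasure (Measure.dirac ((tp, x tp) : ℝ × (Fin n → ℝ)))
        ∧ Measure.dirac ((tp, x tp) : ℝ × (Fin n → ℝ))
            ((Set.Icc (0 : ℝ) T ×ˢ X)ᶜ) = 0)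
    ∧ (∀ v : ℝ × (Fin n → ℝ) → ℝ, ContDiff ℝ 1 v →
        ∫ q, v q ∂(Measure.dirac ((tp, x tp) : ℝ × (Fin n → ℝ))) =
          (∫ y, v (0, y) ∂(Measure.dirac (x 0)))
          + ∫ q, fderiv ℝ v q (1, f q)
              ∂(Measure.map (fun s => (s, x s)) (volume.restrict (Set.Icc (0 : ℝ) tp))))
    ∧ (∀ p : (Fin n → ℝ) → ℝ, Continuous p →
        ∫ q, p q.2 ∂(Measure.dirac ((tp, x tp) : ℝ × (Fin n → ℝ))) = p (x tp)) := by
  have hgraph : Continuous fun s => (s, x s) := continuous_id.prodMk hx.continuous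
  have hsub : Set.Icc 0 tp ⊆ Set.Icc 0 T := Set.Icc_subset_Icc_right htp.2
  refine ⟨⟨inferInstance, ?_⟩, ⟨inferInstance, ?_, inferInstance, ?_⟩, fun v hv => ?_,
    fun p _ => integral_dirac _ _⟩
  · simpa [Measure.dirac_apply] using hx0
  · have hK : MeasurableSet ((fun s => (s, x s)) '' Set.Icc 0 tp) :=
      (isCompact_Icc.image hgraph).measurableSet
    refine measure_mono_null (t := ((fun s => (s, x s)) '' Set.Icc 0 tp)ᶜ) ?_ ?_
    · rw [Set.compl_subset_compl]
      rintro _ ⟨s, hs, rfl⟩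
      exact ⟨hsub hs, hxX s (hsub hs)⟩
    · rw [Measure.map_apply hgraph.measurable hK.compl,
        Measure.restrict_apply (hgraph.measurable hK.compl), Set.preimage_compl]
      refine measure_mono_null ?_ (measure_empty (μ := volume))
      exact fun s hs => hs.1 (Set.mem_image_of_mem _ hs.2)
  · simpa [Measure.dirac_apply] using ⟨htp.1, htp.2, hxX tp htp⟩
  · have hfderiv : Continuous (fderiv ℝ v) := hv.continuous_fderiv one_ne_zero
    have hLie : Continuous fun q => fderiv ℝ v q (1, f q) := by fun_prop
    rw [integral_dirac, integral_dirac,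
      integral_map hgraph.aemeasurable hLie.aestronglyMeasurable,
      integral_Icc_eq_integral_Ioc, ← intervalIntegral.integral_of_le htp.1,
      integral_fderiv_along_trajectory hf hx
        (fun t ht => hode t (hsub (Set.uIcc_of_le htp.1 ▸ ht))) hv]
    ring
end

section
/- Let f : ℝ × ℝⁿ → ℝⁿ be continuous, T > 0, X₀, X ⊆ ℝⁿ, and p : ℝⁿ → ℝ. Suppose v : ℝ × ℝⁿ → ℝ is continuously differentiable and γ ∈ ℝ satisfy the auxiliary-function (dual) constraints: γ ≥ v(0, y) for all y ∈ X₀; L_f v(t, y) ≤ 0 for all (t, y) ∈ [0, T] × X; and v(t, y) ≥ p(y) for all (t, y) ∈ [0, T] × X. Then for every admissible trajectory x(·) on [0, T] (x(0) ∈ X₀, x(t) ∈ X, x'(t) = f(t, x(t)) for t ∈ [0, T]) and every t ∈ [0, T], p(x(t)) ≤ γ. In particular, γ upper bounds the peak value P* = sup over admissible trajectories and times of p(x(t)). -/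
open MeasureTheory

/-- The chain rule for `v` along the graph `s ↦ (s, x s)` of a differentiable curve. -/
theorem hasDerivAt_comp_graph {E : Type*} [NormedAddCommGroup E] [NormedSpace ℝ E]
    {v : ℝ × E → ℝ} {x : ℝ → E} {x' : E} {s : ℝ}
    (hv : DifferentiableAt ℝ v (s, x s)) (hx : HasDerivAt x x' s) :
    HasDerivAt (fun r => v (r, x r)) (fderiv ℝ v (s, x s) (1, x')) s :=
  hv.hasFDerivAt.comp_hasDerivAt s ((hasDerivAt_id s).prodMk hx)

/-- An auxiliary function certificate bounds the peak value along trajectories: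
if `v` is `C¹` and `γ ∈ ℝ` satisfy `γ ≥ v(0, y)` on `X₀`, `L_f v ≤ 0` on `[0, T] × X`
(with `L_f v(t, y) = ∂_t v(t, y) + ∇_y v(t, y)ᵀ f(t, y) = Dv(t,y)[(1, f(t,y))]`),
and `v(t, y) ≥ p(y)` on `[0, T] × X`, then every admissible trajectory `x(·)` on
`[0, T]` satisfies `p(x(t)) ≤ γ` for all `t ∈ [0, T]`. -/
theorem aux_function_peak_bound {n : ℕ}
    (f : ℝ × (Fin n → ℝ) → (Fin n → ℝ)) (hf : Continuous f)
    (T : ℝ) (hT : 0 < T) (X₀ X : Set (Fin n → ℝ)) (p : (Fin n → ℝ) → ℝ)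
    (v : ℝ × (Fin n → ℝ) → ℝ) (hv : ContDiff ℝ 1 v) (γ : ℝ)
    (hinit : ∀ y ∈ X₀, v (0, y) ≤ γ)
    (hlie : ∀ t ∈ Set.Icc (0 : ℝ) T, ∀ y ∈ X, fderiv ℝ v (t, y) (1, f (t, y)) ≤ 0)
    (hvp : ∀ t ∈ Set.Icc (0 : ℝ) T, ∀ y ∈ X, p y ≤ v (t, y))
    (x : ℝ → (Fin n → ℝ)) (hx : Differentiable ℝ x)
    (hx0 : x 0 ∈ X₀) (hxX : ∀ t ∈ Set.Icc (0 : ℝ) T, x t ∈ X)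
    (hode : ∀ t ∈ Set.Icc (0 : ℝ) T, deriv x t = f (t, x t))
    (t : ℝ) (ht : t ∈ Set.Icc (0 : ℝ) T) :
    p (x t) ≤ γ := by
  have hderiv (s : ℝ) :
      HasDerivAt (fun r => v (r, x r)) (fderiv ℝ v (s, x s) (1, deriv x s)) s :=
    hasDerivAt_comp_graph (hv.differentiable one_ne_zero _) (hx s).hasDerivAt
  have hanti : AntitoneOn (fun r => v (r, x r)) (Set.Icc 0 T) := by
    refine antitoneOn_of_deriv_nonpos (convex_Icc 0 T)
      (fun s _ => (hderiv s).continuousAt.continuousWithinAt)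
      (fun s _ => (hderiv s).differentiableAt.differentiableWithinAt) fun s hs => ?_
    have hs' := interior_subset hs
    rw [(hderiv s).deriv, hode s hs']
    exact hlie s hs' (x s) (hxX s hs')
  calc p (x t) ≤ v (t, x t) := hvp t ht _ (hxX t ht)
    _ ≤ v (0, x 0) := hanti (Set.left_mem_Icc.mpr hT.le) ht ht.1
    _ ≤ γ := hinit _ hx0
end

section
/- (Paper's Theorem: the maximin measure program upper bounds maximin peak estimation.) Let f : ℝ × ℝⁿ → ℝⁿ be continuous, T > 0, X₀, X ⊆ ℝⁿ, and let p₁, …, p_N : ℝⁿ → ℝ be continuous. For every admissible trajectory x(·) on [0, T] (x(0) ∈ X₀, x(t) ∈ X, x'(t) = f(t, x(t)) for t ∈ [0, T]) and every t_p ∈ [0, T], there exist q ∈ ℝ, z ∈ ℝ₊^N, and finite Borel measures (μ₀, μ, μ_p) such that: μ₀ is a probability measure supported on X₀; μ, μ_p are supported on [0, T] × X; the weak Liouville constraint ∫ v dμ_p = ∫ v(0, x) dμ₀(x) + ∫ L_f v dμ holds for every continuously differentiable v; q + z_i = ∫ p_i(y) dμ_p(t, y) for all i = 1, …, N; and q =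 min_{1 ≤ i ≤ N} p_i(x(t_p)). Consequently, the supremum of q over all feasible tuples of the maximin measure program is at least the maximin peak value P* = sup over admissible trajectories and times of min_i p_i(x(t)). -/
open MeasureTheory

/-- The occupation measure of the curve `x` on `[0, s]`: the image of Lebesgue measure
on `[0, s]` under `t ↦ (t, x t)`. -/
noncomputable def occupationMeasure {E : Type*} [MeasurableSpace E] (x : ℝ → E) (s : ℝ) :
    Measure (ℝ × E) :=
  (volume.restrict (Set.Icc 0 s)).map fun t => (t, x t)

instance {E : Type*} [MeasurableSpace E] (x : ℝ → E) (s : ℝ) :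
    IsFiniteMeasure (occupationMeasure x s) := by
  unfold occupationMeasure
  infer_instance

theorem dirac_compl_eq_zero {E : Type*} [MeasurableSpace E] [MeasurableSingletonClass E]
    {a : E} {S : Set E} (ha : a ∈ S) : Measure.dirac a Sᶜ = 0 := by
  rw [Measure.dirac_apply]
  simp [ha]

theorem occupationMeasure_compl_eq_zero {E : Type*} [TopologicalSpace E] [T2Space E]
    [SecondCountableTopology E] [MeasurableSpace E] [BorelSpace E] {x : ℝ → E}
    (hx : Continuous x) {s : ℝ} {S : Set (ℝ × E)} (hS : ∀ t ∈ Set.Icc 0 s, (t, x t) ∈ S) :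
    occupationMeasure x s Sᶜ = 0 := by
  have hγ : Continuous fun t => (t, x t) := by fun_prop
  have hK : IsCompact ((fun t => (t, x t)) '' Set.Icc 0 s) := isCompact_Icc.image hγ
  refine measure_mono_null (t := ((fun t => (t, x t)) '' Set.Icc 0 s)ᶜ) ?_ ?_
  · rw [Set.compl_subset_compl]
    exact Set.image_subset_iff.2 hS
  · rw [occupationMeasure, Measure.map_apply hγ.measurable hK.measurableSet.compl]
    refine measure_mono_null (t := (Set.Icc 0 s)ᶜ) (fun t ht hts => ht ⟨t, hts, rfl⟩) ?_
    rw [Measure.restrict_apply measurableSet_Icc.compl]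
    simp

/-- The weak Liouville equation for the occupation measure of a solution of `x' = f (t, x)`. -/
theorem integral_occupationMeasure_lieDerivative {E : Type*} [NormedAddCommGroup E]
    [NormedSpace ℝ E] [SecondCountableTopology E] [MeasurableSpace E] [BorelSpace E]
    {f : ℝ × E → E} (hf : Continuous f) {x : ℝ → E} (hx : Continuous x) {s : ℝ} (hs : 0 ≤ s)
    (hode : ∀ t ∈ Set.Icc 0 s, HasDerivAt x (f (t, x t)) t)
    {v : ℝ × E → ℝ} (hv : ContDiff ℝ 1 v) :
    ∫ y, fderiv ℝ v y (1, f y) ∂occupationMeasure x s = v (s, x s) - v (0, x 0) := by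
  have hγ : Continuous fun t => (t, x t) := by fun_prop
  have hL : Continuous fun y => fderiv ℝ v y (1, f y) :=
    (hv.continuous_fderiv one_ne_zero).clm_apply (by fun_prop)
  rw [occupationMeasure, integral_map hγ.aemeasurable hL.aestronglyMeasurable,
    integral_Icc_eq_integral_Ioc, ← intervalIntegral.integral_of_le hs]
  refine intervalIntegral.integral_eq_sub_of_hasDerivAt (f := fun t => v (t, x t)) ?_
    (hL.comp hγ).continuousOn.intervalIntegrable
  intro t ht
  rw [Set.uIcc_of_le hs] at ht
  exact ((hv.differentiable one_ne_zero).differentiableAt.hasFDerivAt).comp_hasDerivAt t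
    ((hasDerivAt_id t).prodMk (hode t ht))

/-- The maximin measure program upper bounds maximin peak estimation: for every
admissible trajectory `x(·)` on `[0, T]` and every `t_p ∈ [0, T]`, there exist
`q ∈ ℝ`, slacks `z ∈ ℝ₊^N`, and finite Borel measures `(μ₀, μ, μ_p)` such that
`μ₀` is a probability measure supported on `X₀`, `μ, μ_p` are supported on
`[0, T] × X`, the weak Liouville constraint holds for every `C¹` test function
(with `L_f v(t, y) = Dv(t,y)[(1, f(t,y))]`), `q + z_i = ∫ p_i dμ_p` for every `i`,
and `q = min_i p_i(x(t_p))`. Hence the optimal value of the maximin measure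
program is at least the maximin peak value `P*`. -/
theorem maximin_measure_program_feasible {n N : ℕ} (hN : 0 < N)
    (f : ℝ × (Fin n → ℝ) → (Fin n → ℝ)) (hf : Continuous f)
    (T : ℝ) (hT : 0 < T) (X₀ X : Set (Fin n → ℝ))
    (p : Fin N → (Fin n → ℝ) → ℝ) (hp : ∀ i, Continuous (p i))
    (x : ℝ → (Fin n → ℝ)) (hx : Differentiable ℝ x)
    (hx0 : x 0 ∈ X₀) (hxX : ∀ t ∈ Set.Icc (0 : ℝ) T, x t ∈ X)
    (hode : ∀ t ∈ Set.Icc (0 : ℝ) T, deriv x t = f (t, x t))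
    (tp : ℝ) (htp : tp ∈ Set.Icc (0 : ℝ) T) :
    ∃ (q : ℝ) (z : Fin N → ℝ) (μ₀ : Measure (Fin n → ℝ))
      (μ μp : Measure (ℝ × (Fin n → ℝ))),
      (∀ i, 0 ≤ z i)
      ∧ IsProbabilityMeasure μ₀ ∧ μ₀ (X₀ᶜ) = 0
      ∧ IsFiniteMeasure μ ∧ IsFiniteMeasure μp
      ∧ μ ((Set.Icc (0 : ℝ) T ×ˢ X)ᶜ) = 0
      ∧ μp ((Set.Icc (0 : ℝ) T ×ˢ X)ᶜ) = 0
      ∧ (∀ v : ℝ × (Fin n → ℝ) → ℝ, ContDiff ℝ 1 v →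
          ∫ q', v q' ∂μp = (∫ y, v (0, y) ∂μ₀) + ∫ q', fderiv ℝ v q' (1, f q') ∂μ)
      ∧ (∀ i, q + z i = ∫ q' : ℝ × (Fin n → ℝ), p i q'.2 ∂μp)
      ∧ q = ⨅ i, p i (x tp) := by
  have hode' : ∀ t ∈ Set.Icc 0 tp, HasDerivAt x (f (t, x t)) t := fun t ht =>
    hode t ⟨ht.1, ht.2.trans htp.2⟩ ▸ (hx t).hasDerivAt
  refine ⟨⨅ i, p i (x tp), fun i => p i (x tp) - ⨅ j, p j (x tp), Measure.dirac (x 0),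
    occupationMeasure x tp, Measure.dirac (tp, x tp), fun i => ?_, inferInstance,
    dirac_compl_eq_zero hx0, inferInstance, inferInstance, ?_,
    dirac_compl_eq_zero ⟨htp, hxX tp htp⟩, fun v hv => ?_, fun i => ?_, rfl⟩
  · exact sub_nonneg.2 (ciInf_le (Set.finite_range _).bddBelow i)
  · refine occupationMeasure_compl_eq_zero hx.continuous fun t ht => ?_
    have ht' : t ∈ Set.Icc 0 T := ⟨ht.1, ht.2.trans htp.2⟩
    exact ⟨ht', hxX t ht'⟩
  · rw [integral_occupationMeasure_lieDerivative hf hx.continuous htp.1 hode' hv,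
      integral_dirac, integral_dirac]
    ring
  · rw [integral_dirac]
    ring
end

section
/- Weak duality for the maximin dual, trajectory version: let f : ℝ × ℝⁿ → ℝⁿ be continuous, T > 0, X₀, X ⊆ ℝⁿ, and p₁, …, p_N : ℝⁿ → ℝ. Suppose v : ℝ × ℝⁿ → ℝ is continuously differentiable, γ ∈ ℝ, and β ∈ ℝ₊^N with Σᵢ βᵢ = 1 satisfy: γ ≥ v(0, y) for all y ∈ X₀; L_f v(t, y) ≤ 0 for all (t, y) ∈ [0, T] × X; and v(t, y) ≥ Σᵢ βᵢ pᵢ(y) for all (t, y) ∈ [0, T] × X. Then for every admissible trajectory x(·) on [0, T] and every t ∈ [0, T], min_{1 ≤ i ≤ N} pᵢ(x(t)) ≤ γ. -/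
open MeasureTheory

/-- Weak duality for the maximin dual, trajectory version: if `v` is `C¹`, `γ ∈ ℝ`,
and `β ∈ ℝ₊^N` with `∑ᵢ βᵢ = 1` satisfy `γ ≥ v(0, y)` on `X₀`, `L_f v ≤ 0` on
`[0, T] × X` (with `L_f v(t, y) = ∂_t v + ∇_y v ᵀ f = Dv(t,y)[(1, f(t,y))]`), and
`v(t, y) ≥ ∑ᵢ βᵢ pᵢ(y)` on `[0, T] × X`, then for every admissible trajectory
`x(·)` on `[0, T]` and every `t ∈ [0, T]`, `min_i pᵢ(x(t)) ≤ γ`. -/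
theorem maximin_dual_trajectory_bound {n N : ℕ} (hN : 0 < N)
    (f : ℝ × (Fin n → ℝ) → (Fin n → ℝ)) (hf : Continuous f)
    (T : ℝ) (hT : 0 < T) (X₀ X : Set (Fin n → ℝ))
    (p : Fin N → (Fin n → ℝ) → ℝ)
    (v : ℝ × (Fin n → ℝ) → ℝ) (hv : ContDiff ℝ 1 v) (γ : ℝ)
    (β : Fin N → ℝ) (hβ : ∀ i, 0 ≤ β i) (hβ1 : ∑ i, β i = 1)
    (hinit : ∀ y ∈ X₀, v (0, y) ≤ γ)
    (hlie : ∀ t ∈ Set.Icc (0 : ℝ) T, ∀ y ∈ X, fderiv ℝ v (t, y) (1, f (t, y)) ≤ 0)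
    (hvp : ∀ t ∈ Set.Icc (0 : ℝ) T, ∀ y ∈ X, (∑ i, β i * p i y) ≤ v (t, y))
    (x : ℝ → (Fin n → ℝ)) (hx : Differentiable ℝ x)
    (hx0 : x 0 ∈ X₀) (hxX : ∀ t ∈ Set.Icc (0 : ℝ) T, x t ∈ X)
    (hode : ∀ t ∈ Set.Icc (0 : ℝ) T, deriv x t = f (t, x t))
    (t : ℝ) (ht : t ∈ Set.Icc (0 : ℝ) T) :
    (⨅ i, p i (x t)) ≤ γ := by
  have hderiv (s : ℝ) :
      HasDerivAt (fun s => v (s, x s)) (fderiv ℝ v (s, x s) (1, deriv x s)) s :=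
    ((hv.differentiable one_ne_zero) (s, x s)).hasFDerivAt.comp_hasDerivAt s
      ((hasDerivAt_id s).prodMk (hx s).hasDerivAt)
  have hanti : AntitoneOn (fun s => v (s, x s)) (Set.Icc 0 T) := by
    refine antitoneOn_of_deriv_nonpos (convex_Icc 0 T)
      (fun s _ => (hderiv s).continuousAt.continuousWithinAt)
      (fun s _ => (hderiv s).differentiableAt.differentiableWithinAt) fun s hs => ?_
    have hs' := interior_subset hs
    rw [(hderiv s).deriv, hode s hs']
    exact hlie s hs' (x s) (hxX s hs')
  calc (⨅ i, p i (x t)) = ∑ i, β i * ⨅ j, p j (x t) := by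
        rw [← Finset.sum_mul, hβ1, one_mul]
    _ ≤ ∑ i, β i * p i (x t) := Finset.sum_le_sum fun i _ =>
        mul_le_mul_of_nonneg_left (ciInf_le (Set.finite_range _).bddBelow i) (hβ i)
    _ ≤ v (t, x t) := hvp t ht (x t) (hxX t ht)
    _ ≤ v (0, x 0) := hanti (Set.left_mem_Icc.2 hT.le) ht ht.1
    _ ≤ γ := hinit (x 0) hx0
end

section
/- Weak duality between the maximin measure program and its dual: let f : ℝ × ℝⁿ → ℝⁿ be continuous, T > 0, X₀, X ⊆ ℝⁿ, and p₁, …, p_N : ℝⁿ → ℝ continuous. Let (q, z, μ₀, μ, μ_p) be feasible for the primal: q ∈ ℝ, z ∈ ℝ₊^N, μ₀ a Borel probability measure supported on X₀, μ, μ_p finite Borel measures supported on [0, T] × X, satisfying the weak Liouville constraint for all continuously differentiable test functions and q + z_i = ∫ p_i(y) dμ_p(t, y) for all i. Let (v, γ, β) be feasible for the dual: v continuously differentiable, γ ∈ ℝ, β ∈ ℝ₊^N with Σᵢ βᵢ = 1, γ ≥ v(0, y) on X₀, L_f v ≤ 0 on [0, T] × X, and v(t, y) ≥ Σᵢ βᵢ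 pᵢ(y) on [0, T] × X (with the relevant integrability). Then q ≤ γ. -/
open MeasureTheory

/-- Weak duality between the maximin measure program and its dual: if
`(q, z, μ₀, μ, μ_p)` is primal feasible (`z ≥ 0`, `μ₀` a probability measure
supported on `X₀`, `μ, μ_p` finite measures supported on `[0, T] × X`, the weak
Liouville constraint for all `C¹` test functions, and `q + z_i = ∫ p_i dμ_p` for
all `i`) and `(v, γ, β)` is dual feasible (`v` is `C¹`, `β ≥ 0` with `∑ᵢ βᵢ = 1`,
`γ ≥ v(0, ·)` on `X₀`, `L_f v ≤ 0` and `v ≥ ∑ᵢ βᵢ pᵢ` on `[0, T] × X`, with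
`L_f v(t, y) = Dv(t,y)[(1, f(t,y))]`, and the relevant integrability holds), then
`q ≤ γ`. -/
theorem maximin_weak_duality {n N : ℕ} (hN : 0 < N)
    (f : ℝ × (Fin n → ℝ) → (Fin n → ℝ)) (hf : Continuous f)
    (T : ℝ) (hT : 0 < T) (X₀ X : Set (Fin n → ℝ))
    (p : Fin N → (Fin n → ℝ) → ℝ) (hp : ∀ i, Continuous (p i))
    (q : ℝ) (z : Fin N → ℝ) (hz : ∀ i, 0 ≤ z i)
    (μ₀ : Measure (Fin n → ℝ)) (μ μp : Measure (ℝ × (Fin n → ℝ)))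
    [IsProbabilityMeasure μ₀] [IsFiniteMeasure μ] [IsFiniteMeasure μp]
    (hsupp0 : μ₀ (X₀ᶜ) = 0)
    (hsuppμ : μ ((Set.Icc (0 : ℝ) T ×ˢ X)ᶜ) = 0)
    (hsuppp : μp ((Set.Icc (0 : ℝ) T ×ˢ X)ᶜ) = 0)
    (hliou : ∀ w : ℝ × (Fin n → ℝ) → ℝ, ContDiff ℝ 1 w →
      ∫ q', w q' ∂μp = (∫ y, w (0, y) ∂μ₀) + ∫ q', fderiv ℝ w q' (1, f q') ∂μ)
    (hobj : ∀ i, q + z i = ∫ q' : ℝ × (Fin n → ℝ), p i q'.2 ∂μp)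
    (v : ℝ × (Fin n → ℝ) → ℝ) (hv : ContDiff ℝ 1 v) (γ : ℝ)
    (β : Fin N → ℝ) (hβ : ∀ i, 0 ≤ β i) (hβ1 : ∑ i, β i = 1)
    (hinit : ∀ y ∈ X₀, v (0, y) ≤ γ)
    (hlie : ∀ t ∈ Set.Icc (0 : ℝ) T, ∀ y ∈ X, fderiv ℝ v (t, y) (1, f (t, y)) ≤ 0)
    (hvp : ∀ t ∈ Set.Icc (0 : ℝ) T, ∀ y ∈ X, (∑ i, β i * p i y) ≤ v (t, y))
    (hint1 : Integrable v μp)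
    (hint2 : Integrable (fun y => v (0, y)) μ₀)
    (hint3 : Integrable (fun q' => fderiv ℝ v q' (1, f q')) μ)
    (hint4 : ∀ i, Integrable (fun q' : ℝ × (Fin n → ℝ) => p i q'.2) μp) :
    q ≤ γ := by
  have hX₀ : ∀ᵐ y ∂μ₀, y ∈ X₀ := hsupp0
  have hXμ : ∀ᵐ x ∂μ, x ∈ Set.Icc (0 : ℝ) T ×ˢ X := hsuppμ
  have hXp : ∀ᵐ x ∂μp, x ∈ Set.Icc (0 : ℝ) T ×ˢ X := hsuppp
  calc
    q = ∑ i, β i * q := by rw [← Finset.sum_mul, hβ1, one_mul]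
    _ ≤ ∑ i, β i * ∫ x : ℝ × (Fin n → ℝ), p i x.2 ∂μp := by
      gcongr with i
      · exact hβ i
      · linarith [hobj i, hz i]
    _ = ∫ x : ℝ × (Fin n → ℝ), ∑ i, β i * p i x.2 ∂μp := by
      rw [integral_finsetSum _ fun i _ => (hint4 i).const_mul (β i)]
      simp only [integral_const_mul]
    _ ≤ ∫ x, v x ∂μp := by
      refine integral_mono_ae (integrable_finsetSum _ fun i _ => (hint4 i).const_mul (β i))
        hint1 ?_
      filter_upwards [hXp] with x hx using hvp x.1 hx.1 x.2 hx.2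
    _ = (∫ y, v (0, y) ∂μ₀) + ∫ x, fderiv ℝ v x (1, f x) ∂μ := hliou v hv
    _ ≤ (∫ _, γ ∂μ₀) + 0 := by
      refine add_le_add (integral_mono_ae hint2 (integrable_const γ) ?_)
        (integral_nonpos_of_ae ?_)
      · filter_upwards [hX₀] with y hy using hinit y hy
      · filter_upwards [hXμ] with x hx using hlie x.1 hx.1 x.2 hx.2
    _ = γ := by simp
end

section
/- Barrier certificate soundness: let f : ℝⁿ → ℝⁿ be continuous (autonomous dynamics ẋ = f(x)), and let X₀, X_u, X ⊆ ℝⁿ with X₀ ∪ X_u ⊆ X. Suppose B : ℝⁿ → ℝ is continuously differentiable and satisfies B(y) > 0 for all y ∈ X_u, B(y) ≤ 0 for all y ∈ X₀, and ∇B(y)ᵀ f(y) ≤ 0 for all y ∈ X. Then no trajectory starting in X₀ and remaining in X ever enters X_u: for any differentiable x : ℝ → ℝⁿ with x(0) ∈ X₀ and x'(t) = f(x(t)), x(t) ∈ X for all t ∈ [0, T], one has x(t) ∉ X_u for all t ∈ [0, T]. -/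
open MeasureTheory

/-- Barrier certificate soundness for autonomous dynamics `ẋ = f(x)`: if
`B` is `C¹` with `B > 0` on the unsafe set `X_u`, `B ≤ 0` on the initial set `X₀`,
and `∇B(y)ᵀ f(y) = DB(y)[f(y)] ≤ 0` on `X` (where `X₀ ∪ X_u ⊆ X`), then no
trajectory starting in `X₀` and remaining in `X` on `[0, T]` ever enters `X_u`. -/
theorem barrier_certificate_safety {n : ℕ}
    (f : (Fin n → ℝ) → (Fin n → ℝ)) (hf : Continuous f)
    (X₀ Xu X : Set (Fin n → ℝ)) (hsub : X₀ ∪ Xu ⊆ X)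
    (B : (Fin n → ℝ) → ℝ) (hB : ContDiff ℝ 1 B)
    (hBu : ∀ y ∈ Xu, 0 < B y)
    (hB0 : ∀ y ∈ X₀, B y ≤ 0)
    (hBf : ∀ y ∈ X, fderiv ℝ B y (f y) ≤ 0)
    (T : ℝ) (x : ℝ → (Fin n → ℝ)) (hx : Differentiable ℝ x)
    (hx0 : x 0 ∈ X₀)
    (hode : ∀ t ∈ Set.Icc (0 : ℝ) T, deriv x t = f (x t))
    (hxX : ∀ t ∈ Set.Icc (0 : ℝ) T, x t ∈ X)
    (t : ℝ) (ht : t ∈ Set.Icc (0 : ℝ) T) :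
    x t ∉ Xu := by
  have hBx : ∀ s, HasDerivAt (fun s => B (x s)) (fderiv ℝ B (x s) (deriv x s)) s := fun s =>
    (hB.differentiable one_ne_zero (x s)).hasFDerivAt.comp_hasDerivAt s (hx s).hasDerivAt
  have hanti : AntitoneOn (fun s => B (x s)) (Set.Icc 0 T) := by
    refine antitoneOn_of_hasDerivWithinAt_nonpos (convex_Icc 0 T)
      (fun s _ => (hBx s).continuousAt.continuousWithinAt)
      (fun s _ => (hBx s).hasDerivWithinAt) fun s hs => ?_
    have hs' := interior_subset hs
    rw [hode s hs']
    exact hBf _ (hxX s hs')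
  intro htu
  have h0 : (0 : ℝ) ∈ Set.Icc 0 T := ⟨le_rfl, ht.1.trans ht.2⟩
  exact (hBu _ htu).not_ge ((hanti h0 ht ht.1).trans (hB0 _ hx0))
end

section
/- A trajectory reaching the unsafe set yields a feasible solution to the unsafe measure program: let f : ℝⁿ → ℝⁿ be continuous, X₀, X_u, X ⊆ ℝⁿ, and suppose x : ℝ → ℝⁿ is differentiable with x(0) ∈ X₀, x'(t) = f(x(t)) and x(t) ∈ X for all t ∈ [0, t_u], and x(t_u) ∈ X_u for some t_u ≥ 0. Define μ₀ = δ_{x(0)}, μ_u = δ_{x(t_u)}, and μ the pushforward of Lebesgue measure restricted to [0, t_u] under s ↦ x(s). Then μ₀ is a probability measure supported on X₀, μ is supported on X, μ_u is a probability measure supported on X_u, and for every continuously differentiable g : ℝⁿ → ℝ, ∫ g dμ_u = ∫ g dμ₀ + ∫ ∇g(y)ᵀ f(y) dμ(y). -/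
open MeasureTheory

/-- A trajectory reaching the unsafe set yields a feasible solution to the unsafe
measure program: for autonomous dynamics `ẋ = f(x)`, a trajectory `x(·)` with
`x(0) ∈ X₀`, `x(t) ∈ X` on `[0, t_u]`, and `x(t_u) ∈ X_u`, the measures
`μ₀ = δ_{x(0)}`, `μ_u = δ_{x(t_u)}`, and `μ` the occupation measure (pushforward
of `Leb|_{[0, t_u]}` under `s ↦ x(s)`) satisfy: `μ₀` is a probability measure
supported on `X₀`, `μ` is supported on `X`, `μ_u` is a probability measure
supported on `X_u`, and the autonomous weak Liouville constraint
`∫ g dμ_u = ∫ g dμ₀ + ∫ ∇g(y)ᵀ f(y) dμ(y)` (with `∇g(y)ᵀ f(y) = Dg(y)[f(y)]`)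
holds for every continuously differentiable `g`. -/
theorem unsafe_trajectory_feasible_measures {n : ℕ}
    (f : (Fin n → ℝ) → (Fin n → ℝ)) (hf : Continuous f)
    (X₀ Xu X : Set (Fin n → ℝ))
    (x : ℝ → (Fin n → ℝ)) (hx : Differentiable ℝ x)
    (tu : ℝ) (htu : 0 ≤ tu)
    (hx0 : x 0 ∈ X₀)
    (hode : ∀ t ∈ Set.Icc (0 : ℝ) tu, deriv x t = f (x t))
    (hxX : ∀ t ∈ Set.Icc (0 : ℝ) tu, x t ∈ X)
    (hxu : x tu ∈ Xu) :
    (IsProbabilityMeasure (Measure.dirac (x 0)) ∧ Measure.dirac (x 0) (X₀ᶜ) = 0)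
    ∧ Measure.map x (volume.restrict (Set.Icc (0 : ℝ) tu)) (Xᶜ) = 0
    ∧ (IsProbabilityMeasure (Measure.dirac (x tu)) ∧ Measure.dirac (x tu) (Xuᶜ) = 0)
    ∧ (∀ g : (Fin n → ℝ) → ℝ, ContDiff ℝ 1 g →
        ∫ y, g y ∂(Measure.dirac (x tu)) =
          (∫ y, g y ∂(Measure.dirac (x 0)))
          + ∫ y, fderiv ℝ g y (f y)
              ∂(Measure.map x (volume.restrict (Set.Icc (0 : ℝ) tu)))) := by
  refine ⟨⟨inferInstance, ?_⟩, ?_, ⟨inferInstance, ?_⟩, fun g hg ↦ ?_⟩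
  · rw [Measure.dirac_apply]
    simpa using hx0
  · have hK : IsCompact (x '' Set.Icc (0 : ℝ) tu) := isCompact_Icc.image hx.continuous
    refine measure_mono_null (Set.compl_subset_compl.2 (Set.image_subset_iff.2 hxX)) ?_
    rw [Measure.map_apply hx.continuous.measurable hK.measurableSet.compl,
      Measure.restrict_apply (hx.continuous.measurable hK.measurableSet.compl)]
    convert measure_empty (μ := (volume : Measure ℝ))
    ext t
    simp only [Set.mem_inter_iff, Set.mem_preimage, Set.mem_compl_iff, Set.mem_empty_iff_false,
      iff_false, not_and]
    exact fun h ht ↦ h (Set.mem_image_of_mem x ht)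
  · rw [Measure.dirac_apply]
    simpa using hxu
  · have hc : Continuous fun y ↦ fderiv ℝ g y (f y) :=
      (hg.continuous_fderiv one_ne_zero).clm_apply hf
    rw [integral_dirac, integral_dirac,
      integral_map hx.continuous.aemeasurable hc.aestronglyMeasurable,
      integral_Icc_eq_integral_Ioc, ← intervalIntegral.integral_of_le htu,
      intervalIntegral.integral_eq_sub_of_hasDerivAt (f := fun t ↦ g (x t))
        (f' := fun t ↦ fderiv ℝ g (x t) (f (x t)))
        (fun t ht ↦ ?_) ((hc.comp hx.continuous).intervalIntegrable 0 tu)]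
    · ring
    · rw [Set.uIcc_of_le htu] at ht
      rw [← hode t ht]
      exact ((hg.differentiable one_ne_zero) (x t)).hasFDerivAt.comp_hasDerivAt t
        (hx t).hasDerivAt
end

section
/- Safety certification via a negative maximin dual certificate: let f : ℝ × ℝⁿ → ℝⁿ be continuous, T > 0, X₀, X ⊆ ℝⁿ, let p₁, …, p_N : ℝⁿ → ℝ be continuous, and define the unsafe set X_u = {y ∈ X : pᵢ(y) ≥ 0 for all i = 1, …, N}. Suppose there exist a continuously differentiable v : ℝ × ℝⁿ → ℝ, γ < 0, and β ∈ ℝ₊^N with Σᵢ βᵢ = 1 such that γ ≥ v(0, y) for all y ∈ X₀, L_f v(t, y) ≤ 0 for all (t, y) ∈ [0, T] × X, and v(t, y) ≥ Σᵢ βᵢ pᵢ(y) for all (t, y) ∈ [0, T] × X. Then every admissible trajectory on [0, T] avoids the unsafe set: for every admissible trajectory x(·) and every t ∈ [0, T], x(t) ∉ X_u. -/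
open MeasureTheory

/-- A function differentiable along a curve, with nonpositive Lie derivative on `[0, T]`, is
antitone along that curve. -/
theorem antitoneOn_comp_of_fderiv_nonpos {E : Type*} [NormedAddCommGroup E] [NormedSpace ℝ E]
    {v : ℝ × E → ℝ} (hv : Differentiable ℝ v) {x : ℝ → E} (hx : Differentiable ℝ x) {T : ℝ}
    (h : ∀ t ∈ Set.Icc (0 : ℝ) T, fderiv ℝ v (t, x t) (1, deriv x t) ≤ 0) :
    AntitoneOn (fun t => v (t, x t)) (Set.Icc 0 T) := by
  have hd : ∀ t, HasDerivAt (fun s => v (s, x s)) (fderiv ℝ v (t, x t) (1, deriv x t)) t :=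
    fun t => (hv (t, x t)).hasFDerivAt.comp_hasDerivAt t
      ((hasDerivAt_id t).prodMk (hx t).hasDerivAt)
  refine antitoneOn_of_deriv_nonpos (convex_Icc 0 T)
    (fun t _ => (hd t).continuousAt.continuousWithinAt)
    (fun t _ => (hd t).differentiableAt.differentiableWithinAt) fun t ht => ?_
  rw [(hd t).deriv]
  exact h t (interior_subset ht)

/-- Safety certification via a negative maximin dual certificate: with unsafe set
`X_u = {y ∈ X : pᵢ(y) ≥ 0 for all i}`, if there exist a `C¹` function `v`, a
scalar `γ < 0`, and weights `β ∈ ℝ₊^N` with `∑ᵢ βᵢ = 1` such that `γ ≥ v(0, y)`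
on `X₀`, `L_f v(t, y) ≤ 0` on `[0, T] × X` (with
`L_f v(t, y) = ∂_t v + ∇_y v ᵀ f = Dv(t,y)[(1, f(t,y))]`), and
`v(t, y) ≥ ∑ᵢ βᵢ pᵢ(y)` on `[0, T] × X`, then every admissible trajectory on
`[0, T]` avoids the unsafe set. -/
theorem maximin_safety_margin {n N : ℕ} (hN : 0 < N)
    (f : ℝ × (Fin n → ℝ) → (Fin n → ℝ)) (hf : Continuous f)
    (T : ℝ) (hT : 0 < T) (X₀ X : Set (Fin n → ℝ))
    (p : Fin N → (Fin n → ℝ) → ℝ) (hp : ∀ i, Continuous (p i))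
    (v : ℝ × (Fin n → ℝ) → ℝ) (hv : ContDiff ℝ 1 v)
    (γ : ℝ) (hγ : γ < 0)
    (β : Fin N → ℝ) (hβ : ∀ i, 0 ≤ β i) (hβ1 : ∑ i, β i = 1)
    (hinit : ∀ y ∈ X₀, v (0, y) ≤ γ)
    (hlie : ∀ t ∈ Set.Icc (0 : ℝ) T, ∀ y ∈ X, fderiv ℝ v (t, y) (1, f (t, y)) ≤ 0)
    (hvp : ∀ t ∈ Set.Icc (0 : ℝ) T, ∀ y ∈ X, (∑ i, β i * p i y) ≤ v (t, y))
    (x : ℝ → (Fin n → ℝ)) (hx : Differentiable ℝ x)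
    (hx0 : x 0 ∈ X₀) (hxX : ∀ t ∈ Set.Icc (0 : ℝ) T, x t ∈ X)
    (hode : ∀ t ∈ Set.Icc (0 : ℝ) T, deriv x t = f (t, x t))
    (t : ℝ) (ht : t ∈ Set.Icc (0 : ℝ) T) :
    x t ∉ {y ∈ X | ∀ i, 0 ≤ p i y} := by
  rintro ⟨-, hpos⟩
  have hanti := antitoneOn_comp_of_fderiv_nonpos (hv.differentiable one_ne_zero) hx
    fun s hs => by
      rw [hode s hs]
      exact hlie s hs (x s) (hxX s hs)
  have hle : v (t, x t) ≤ v (0, x 0) := hanti (Set.left_mem_Icc.2 hT.le) ht ht.1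
  have hsum : 0 ≤ ∑ i, β i * p i (x t) :=
    Finset.sum_nonneg fun i _ => mul_nonneg (hβ i) (hpos i)
  linarith [hinit _ hx0, hvp t ht _ (hxX t ht)]
end
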